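/- arXiv:2201.09047 — 4 statements merged into one kernel-verified Lean document; each statement's English description precedes it below -/
import Mathlib

section
/- (Individual rationality at the first time step.) Let $n \ge 2$ workers be indexed so that $b_1/Re_1 \le \cdots \le b_n/Re_n$ with $Re_i > 0$ and $b_i > 0$, let $B_1 > 0$ be the first-round budget and $T \ge 1$ the number of global iterations, and let $1 \le k < n$ satisfy $T\, b_k / Re_k \le B_1 / \sum_{j=1}^{k} Re_j$. Set $\rho^{\ast} = \frac{1}{T}\min\bigl(B_1 / \sum_{j=1}^{k} Re_j,\ T\, b_{k+1}/Re_{k+1}\bigr)$ and pay each selected worker $i \le k$ the amount $p_i = T \cdot Re_i \cdot \rho^{\ast}$. Then $p_i \ge T \cdot b_i$ for every $i \le k$; in particular, if worker $i$ bids his true per-iteration cost $c_i = b_i$, his utility $p_i - T c_i$ is nonnegative. -/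
/-- Individual rationality at the first time step: every selected worker's
payment `p_i = T · Re_i · ρ*` is at least `T · b_i`; in particular a truthful bidder
(`c_i = b_i`) has nonnegative utility `p_i - T c_i`. -/
theorem individual_rationality_first_step
    (n : ℕ) (hn : 2 ≤ n)
    (b Re : ℕ → ℝ)
    (hb : ∀ i, 1 ≤ i → i ≤ n → 0 < b i)
    (hRe : ∀ i, 1 ≤ i → i ≤ n → 0 < Re i)
    (hsort : ∀ i j, 1 ≤ i → i ≤ j → j ≤ n → b i / Re i ≤ b j / Re j)
    (B₁ : ℝ) (hB : 0 < B₁)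
    (T : ℕ) (hT : 1 ≤ T)
    (k : ℕ) (hk1 : 1 ≤ k) (hkn : k < n)
    (hcond : (T : ℝ) * b k / Re k ≤ B₁ / ∑ j ∈ Finset.Icc 1 k, Re j)
    (ρstar : ℝ)
    (hρstar : ρstar =
      (min (B₁ / ∑ j ∈ Finset.Icc 1 k, Re j) ((T : ℝ) * b (k + 1) / Re (k + 1))) / T)
    (p : ℕ → ℝ)
    (hp : ∀ i, 1 ≤ i → i ≤ k → p i = (T : ℝ) * Re i * ρstar) :
    ∀ i, 1 ≤ i → i ≤ k →
      (T : ℝ) * b i ≤ p i ∧ ∀ c : ℝ, c = b i → 0 ≤ p i - (T : ℝ) * c := by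
  intro i hi hik
  have hTpos : (0 : ℝ) < T := by exact_mod_cast hT
  have hRei : 0 < Re i := hRe i hi (by omega)
  have hdensity : b i / Re i ≤ ρstar := by
    rw [hρstar, le_div_iff₀ hTpos, mul_comm]
    refine le_min (le_trans ?_ hcond) ?_
    · rw [mul_div_assoc]
      exact mul_le_mul_of_nonneg_left (hsort i k hi hik hkn.le) hTpos.le
    · rw [mul_div_assoc]
      exact mul_le_mul_of_nonneg_left (hsort i (k + 1) hi (by omega) hkn) hTpos.le
  have hpay : (T : ℝ) * b i ≤ p i := by
    rw [hp i hi hik, mul_assoc]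
    exact mul_le_mul_of_nonneg_left ((div_le_iff₀' hRei).mp hdensity) hTpos.le
  refine ⟨hpay, ?_⟩
  rintro c rfl
  exact sub_nonneg.mpr hpay
end

section
/- (Bid monotonicity of the proportional share allocation rule.) Let $U$ be a finite set of workers with positive reputations $Re_j > 0$ and cost densities $\rho_j > 0$ for $j \in U$, and let $B > 0$. Suppose worker $i \in U$ wins, i.e. $\rho_i \le B / \sum_{j \in U : \rho_j \le \rho_i} Re_j$. If worker $i$ lowers his cost density to $\rho'_i \le \rho_i$ while all other workers' densities are unchanged ($\rho'_j = \rho_j$ for $j \ne i$), then worker $i$ still wins: $\rho'_i \le B / \sum_{j \in U : \rho'_j \le \rho'_i} Re_j$. -/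
/-- Bid monotonicity of the proportional share allocation rule: if worker
`i` wins with cost density `ρ i`, then he still wins after lowering his cost density to
`ρ' i ≤ ρ i` (all other workers' densities unchanged). -/
theorem proportional_share_bid_monotone {ι : Type*}
    (U : Finset ι)
    (Re ρ ρ' : ι → ℝ)
    (hRe : ∀ j ∈ U, 0 < Re j)
    (hρ : ∀ j ∈ U, 0 < ρ j)
    (B : ℝ) (hB : 0 < B)
    (i : ι) (hi : i ∈ U)
    (hwin : ρ i ≤ B / ∑ j ∈ U.filter (fun j => ρ j ≤ ρ i), Re j)
    (hρ'pos : 0 < ρ' i) (hlower : ρ' i ≤ ρ i)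
    (hother : ∀ j ∈ U, j ≠ i → ρ' j = ρ j) :
    ρ' i ≤ B / ∑ j ∈ U.filter (fun j => ρ' j ≤ ρ' i), Re j := by
  have hsub : U.filter (fun j => ρ' j ≤ ρ' i) ⊆ U.filter (fun j => ρ j ≤ ρ i) := by
    intro j hj
    obtain ⟨hjU, hle⟩ := Finset.mem_filter.mp hj
    refine Finset.mem_filter.mpr ⟨hjU, ?_⟩
    by_cases hji : j = i
    · rw [hji]
    · exact hother j hjU hji ▸ hle.trans hlower
  have hsum : ∑ j ∈ U.filter (fun j => ρ' j ≤ ρ' i), Re j ≤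
      ∑ j ∈ U.filter (fun j => ρ j ≤ ρ i), Re j :=
    Finset.sum_le_sum_of_subset_of_nonneg hsub
      fun j hj _ => (hRe j (Finset.mem_filter.mp hj).1).le
  have hpos : 0 < ∑ j ∈ U.filter (fun j => ρ' j ≤ ρ' i), Re j :=
    Finset.sum_pos (fun j hj => hRe j (Finset.mem_filter.mp hj).1)
      ⟨i, Finset.mem_filter.mpr ⟨hi, le_rfl⟩⟩
  exact (hlower.trans hwin).trans (div_le_div_of_nonneg_left hB.le hpos hsum)
end

section
/- (Winner characterization of the greedy proportional share rule.) Let $n \ge 2$ workers have pairwise distinct cost densities sorted increasingly, $\rho_1 < \rho_2 < \cdots < \rho_n$, positive reputations $Re_j > 0$, and budget $B > 0$. Let $k$ be the largest index satisfying the proportional share condition $\rho_k \le B / \sum_{j=1}^{k} Re_j$ (assume such an index exists and $k < n$). Then for every worker $i$: $i \le k$ if and only if $\rho_i \le B / \sum_{j : \rho_j \le \rho_i} Re_j$. -/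
/-- Winner characterization of the greedy proportional share rule: with
pairwise distinct, increasingly sorted cost densities and `k` the largest index
satisfying the proportional share condition, worker `i` is selected (`i ≤ k`) iff
`ρ i ≤ B / ∑_{j : ρ j ≤ ρ i} Re j`. -/
theorem proportional_share_winner_characterization
    (n : ℕ) (hn : 2 ≤ n)
    (ρ Re : ℕ → ℝ)
    (hsort : ∀ i j, 1 ≤ i → i < j → j ≤ n → ρ i < ρ j)
    (hRe : ∀ j, 1 ≤ j → j ≤ n → 0 < Re j)
    (B : ℝ) (hB : 0 < B)
    (k : ℕ) (hk1 : 1 ≤ k) (hkn : k < n)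
    (hcond : ρ k ≤ B / ∑ j ∈ Finset.Icc 1 k, Re j)
    (hmax : ∀ m, k < m → m ≤ n → ¬ (ρ m ≤ B / ∑ j ∈ Finset.Icc 1 m, Re j)) :
    ∀ i, 1 ≤ i → i ≤ n →
      (i ≤ k ↔ ρ i ≤ B / ∑ j ∈ (Finset.Icc 1 n).filter (fun j => ρ j ≤ ρ i), Re j) := by
  intro i hi hin
  have hmono : StrictMonoOn ρ (Set.Icc 1 n) := fun a ha b hb hab => hsort a b ha.1 hab hb.2
  have hfilter : (Finset.Icc 1 n).filter (fun j => ρ j ≤ ρ i) = Finset.Icc 1 i := by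
    ext j
    simp only [Finset.mem_filter, Finset.mem_Icc]
    constructor
    · rintro ⟨hj, hle⟩
      exact ⟨hj.1, (hmono.le_iff_le hj ⟨hi, hin⟩).1 hle⟩
    · rintro ⟨hj, hji⟩
      exact ⟨⟨hj, hji.trans hin⟩, (hmono.le_iff_le ⟨hj, hji.trans hin⟩ ⟨hi, hin⟩).2 hji⟩
  rw [hfilter]
  refine ⟨fun hik => ?_, fun h => not_lt.1 fun hki => hmax i hki hin h⟩
  have hpos : 0 < ∑ j ∈ Finset.Icc 1 i, Re j :=
    Finset.sum_pos
      (fun j hj => hRe j (Finset.mem_Icc.1 hj).1 ((Finset.mem_Icc.1 hj).2.trans hin))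
      (Finset.nonempty_Icc.2 hi)
  have hsum : ∑ j ∈ Finset.Icc 1 i, Re j ≤ ∑ j ∈ Finset.Icc 1 k, Re j :=
    Finset.sum_le_sum_of_subset_of_nonneg (Finset.Icc_subset_Icc_right hik) fun j hj _ =>
      (hRe j (Finset.mem_Icc.1 hj).1 ((Finset.mem_Icc.1 hj).2.trans hkn.le)).le
  calc ρ i ≤ ρ k := (hmono.le_iff_le ⟨hi, hin⟩ ⟨hk1, hkn.le⟩).2 hik
    _ ≤ B / ∑ j ∈ Finset.Icc 1 k, Re j := hcond
    _ ≤ B / ∑ j ∈ Finset.Icc 1 i, Re j := div_le_div_of_nonneg_left hB.le hpos hsum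
end

section
/- (Monotonicity of the payment density threshold in the budget.) Let $n \ge 2$ workers have nondecreasing cost densities $\rho_1 \le \cdots \le \rho_n$ and positive reputations $Re_j > 0$. For a budget $B > 0$ with $\rho_1 \le B/Re_1$, let $k(B)$ be the largest index $k$ with $\rho_k \le B / \sum_{j=1}^{k} Re_j$, and define the payment density threshold $\rho^{\ast}(B) = \min\bigl(B / \sum_{j=1}^{k(B)} Re_j,\ \rho_{k(B)+1}\bigr)$. Then for budgets $0 < B \le B''$ with $k(B'') < n$, one has $\rho^{\ast}(B) \le \rho^{\ast}(B'')$: as the sample budget grows over time steps, the payment density threshold never decreases, so already-selected workers' payments are only ever revised upward. -/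
/-- Monotonicity of the payment density threshold in the budget: with
`kB`, `kB''` the greedy cutoffs for budgets `B ≤ B''` and `kB'' < n`, the payment
density threshold `ρ*(B) = min(B / ∑_{j=1}^{k(B)} Re_j, ρ_{k(B)+1})` satisfies
`ρ*(B) ≤ ρ*(B'')`. -/
theorem payment_threshold_monotone_in_budget
    (n : ℕ) (hn : 2 ≤ n)
    (ρ Re : ℕ → ℝ)
    (hsort : ∀ i j, 1 ≤ i → i ≤ j → j ≤ n → ρ i ≤ ρ j)
    (hRe : ∀ j, 1 ≤ j → j ≤ n → 0 < Re j)
    (B B'' : ℝ) (hB : 0 < B) (hBB : B ≤ B'')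
    (hstart : ρ 1 ≤ B / Re 1)
    (kB kB'' : ℕ)
    (hkB : 1 ≤ kB ∧ kB ≤ n ∧ ρ kB ≤ B / ∑ j ∈ Finset.Icc 1 kB, Re j ∧
      ∀ m, 1 ≤ m → m ≤ n → ρ m ≤ B / ∑ j ∈ Finset.Icc 1 m, Re j → m ≤ kB)
    (hkB'' : 1 ≤ kB'' ∧ kB'' ≤ n ∧ ρ kB'' ≤ B'' / ∑ j ∈ Finset.Icc 1 kB'', Re j ∧
      ∀ m, 1 ≤ m → m ≤ n → ρ m ≤ B'' / ∑ j ∈ Finset.Icc 1 m, Re j → m ≤ kB'')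
    (hkB''n : kB'' < n) :
    min (B / ∑ j ∈ Finset.Icc 1 kB, Re j) (ρ (kB + 1)) ≤
      min (B'' / ∑ j ∈ Finset.Icc 1 kB'', Re j) (ρ (kB'' + 1)) := by
  obtain ⟨hk1, hkn, hkρ, -⟩ := hkB
  obtain ⟨-, hkn'', hkρ'', hmax''⟩ := hkB''
  have hdiv : B / ∑ j ∈ Finset.Icc 1 kB, Re j ≤ B'' / ∑ j ∈ Finset.Icc 1 kB, Re j := by
    refine div_le_div_of_nonneg_right hBB (Finset.sum_nonneg fun j hj => ?_)
    rw [Finset.mem_Icc] at hj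
    exact (hRe j hj.1 (hj.2.trans hkn)).le
  rcases (hmax'' kB hk1 hkn (hkρ.trans hdiv)).eq_or_lt with rfl | hlt
  · exact min_le_min_right _ hdiv
  · have hnext : ρ (kB + 1) ≤ ρ kB'' := hsort _ _ (by omega) hlt hkn''
    exact (min_le_right _ _).trans (le_min (hnext.trans hkρ'')
      (hsort _ _ (by omega) (by omega) hkB''n))
end
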